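/- Let T ∈ ℝ and let h : ℝ × (−∞, T) → ℝ be a support-function solution of the affine curve shortening flow, i.e. h is smooth, 2π-periodic in θ, satisfies ∂²h/∂θ² + h > 0 everywhere, and ∂h/∂t = −(∂²h/∂θ² + h)^(−1/3). Then the solution is a shrinking ellipse: there exist T₀ ≥ T, a point c ∈ ℝ², and a symmetric positive definite 2×2 matrix Q₀ with det Q₀ = 1, such that h(θ, t) = ⟨c, u(θ)⟩ + ((4/3)(T₀ − t))^(3/4) · √(u(θ)ᵀ Q₀ u(θ)) for all θ ∈ ℝ and all t < T, where u(θ) = (cos θ, sin θ). -/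

import Mathlib

open Real Set Matrix

noncomputable section

/-- The unit normal vector `u(θ) = (cos θ, sin θ)`. -/
noncomputable def normalVec (θ : ℝ) : Fin 2 → ℝ := ![Real.cos θ, Real.sin θ]

/-- **Wirtinger's inequality** on the circle of length `2π`. -/
theorem integral_sq_le_integral_deriv_sq {g g1 : ℝ → ℝ} (hg : ∀ x, HasDerivAt g (g1 x) x)
    (hg1 : Continuous g1) (hper : g (2 * π) = g 0) (hmean : ∫ x in 0..2 * π, g x = 0) :
    ∫ x in 0..2 * π, g x ^ 2 ≤ ∫ x in 0..2 * π, g1 x ^ 2 := by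
  have hpos : (0 : ℝ) < 2 * π := by positivity
  have hgc : Continuous g := continuous_iff_continuousAt.2 fun x => (hg x).continuousAt
  have mem : ∀ f : ℝ → ℝ, Continuous f → MeasureTheory.MemLp (fun x => (f x : ℂ)) 2
      (MeasureTheory.volume.restrict (Ioc 0 (2 * π))) := fun f hf => by
    have hc : Continuous (fun x => (f x : ℂ)) := by fun_prop
    obtain ⟨C, hC⟩ := isCompact_Icc.exists_bound_of_continuousOn (s := Icc 0 (2 * π)) hc.continuousOn
    refine MeasureTheory.MemLp.of_bound hc.aestronglyMeasurable C ?_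
    filter_upwards [MeasureTheory.ae_restrict_mem measurableSet_Ioc] with x hx
    exact hC x (Ioc_subset_Icc_self hx)
  have h0 := hasSum_sq_fourierCoeffOn hpos (mem g hgc)
  have h1 := hasSum_sq_fourierCoeffOn hpos (mem g1 hg1)
  have key := hasSum_le (fun n => ?_) h0 h1
  · simp only [sub_zero, smul_eq_mul, Complex.norm_real, Real.norm_eq_abs, sq_abs] at key
    exact le_of_mul_le_mul_left key (by positivity)
  · by_cases hn : n = 0
    · subst hn
      have : fourierCoeffOn hpos (fun x => (g x : ℂ)) 0 = 0 := by
        rw [fourierCoeffOn_eq_integral]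
        simp [intervalIntegral.integral_ofReal, hmean]
      rw [this]; simp
    · rw [fourierCoeffOn_of_hasDerivAt hpos hn (fun x _ => (hg x).ofReal_comp)
        ((Complex.continuous_ofReal.comp hg1).intervalIntegrable _ _), hper]
      gcongr
      have h1n : (1 : ℝ) ≤ |(n : ℝ)| := by
        exact_mod_cast Int.one_le_abs hn
      simp only [sub_self, mul_zero, zero_sub, norm_mul, norm_div, norm_neg, Complex.norm_I,
        norm_one, Complex.norm_real, Complex.norm_intCast, Complex.ofReal_zero, sub_zero,
        Complex.norm_ofNat, Real.norm_eq_abs, abs_of_pos pi_pos, mul_one]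
      have hA := norm_nonneg (fourierCoeffOn hpos (fun x => (g1 x : ℂ)) n)
      generalize ‖fourierCoeffOn hpos (fun x => (g1 x : ℂ)) n‖ = A at hA ⊢
      rw [abs_two, one_div_mul_eq_div, div_le_iff₀ (by positivity)]
      nlinarith [mul_le_mul_of_nonneg_left h1n (show 0 ≤ 2 * π * A by positivity)]

/-- Cauchy-Schwarz for continuous functions on an interval. -/
theorem sq_integral_mul_le {f g : ℝ → ℝ} (hf : Continuous f) (hg : Continuous g) {a b : ℝ}
    (hab : a ≤ b) :
    (∫ x in a..b, f x * g x) ^ 2 ≤ (∫ x in a..b, f x ^ 2) * ∫ x in a..b, g x ^ 2 := by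
  have h := discrim_le_zero (a := ∫ x in a..b, f x ^ 2) (b := 2 * ∫ x in a..b, f x * g x)
    (c := ∫ x in a..b, g x ^ 2) fun s => by
      have : 0 ≤ ∫ x in a..b, (s * f x + g x) ^ 2 :=
        intervalIntegral.integral_nonneg hab fun _ _ => sq_nonneg _
      have e : ∫ x in a..b, (s * f x + g x) ^ 2 =
          ∫ x in a..b, ((s * s) * f x ^ 2 + (2 * s) * (f x * g x)) + g x ^ 2 := by
        congr 1; ext x; ring
      rw [e, intervalIntegral.integral_add, intervalIntegral.integral_add,
        intervalIntegral.integral_const_mul, intervalIntegral.integral_const_mul] at this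
      · linarith
      all_goals exact Continuous.intervalIntegrable (by fun_prop) _ _
  unfold discrim at h
  nlinarith

/-- Wirtinger's inequality with respect to a reparametrisation `φ` of the circle. -/
theorem integral_sq_mul_le_integral_deriv_sq_div {g g1 φ w : ℝ → ℝ}
    (hg : ∀ x, HasDerivAt g (g1 x) x) (hg1 : Continuous g1) (hper : g (2 * π) = g 0)
    (hφ : ∀ x, HasDerivAt φ (w x) x) (hw : Continuous w) (hw0 : ∀ x, 0 < w x)
    (hwper : Function.Periodic w (2 * π)) (hφ0 : φ 0 = 0) (hφ1 : φ (2 * π) = 2 * π)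
    (hmean : ∫ x in 0..2 * π, g x * w x = 0) :
    ∫ x in 0..2 * π, g x ^ 2 * w x ≤ ∫ x in 0..2 * π, g1 x ^ 2 / w x := by
  have hmono : StrictMono φ := strictMono_of_hasDerivAt_pos hφ hw0
  have hφc : Continuous φ := continuous_iff_continuousAt.2 fun x => (hφ x).continuousAt
  have hadd : ∀ x, φ (x + 2 * π) = φ x + 2 * π := by
    have hd : ∀ x, HasDerivAt (fun x => φ (x + 2 * π) - φ x) 0 x := fun x => by
      have h := ((hφ (x + 2 * π)).comp_add_const x (2 * π)).sub (hφ x)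
      rwa [hwper x, sub_self] at h
    intro x
    have := is_const_of_deriv_eq_zero (fun x => (hd x).differentiableAt) (fun x => (hd x).deriv) x 0
    simp only [zero_add, hφ1, hφ0] at this
    linarith
  have hsurj : Function.Surjective φ := fun y => by
    have hP : Function.Periodic (fun x => φ x - x) (2 * π) := fun x => by
      simp only [hadd]; ring
    have hn : φ (⌊y / (2 * π)⌋ * (2 * π)) = ⌊y / (2 * π)⌋ * (2 * π) := by
      have := hP.int_mul_eq ⌊y / (2 * π)⌋
      simp only [hφ0] at this
      linarith
    have h1 := Int.floor_le (y / (2 * π))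
    have h2 := (Int.lt_floor_add_one (y / (2 * π))).le
    rw [le_div_iff₀ (by positivity)] at h1
    rw [div_le_iff₀ (by positivity)] at h2
    set a : ℝ := ⌊y / (2 * π)⌋ * (2 * π)
    obtain ⟨x, -, hx⟩ := intermediate_value_Icc (show a ≤ a + 2 * π by linarith [pi_pos])
      hφc.continuousOn (show y ∈ Icc (φ a) (φ (a + 2 * π)) by
        rw [hadd, hn]; exact ⟨h1, by simp only [a]; linarith⟩)
    exact ⟨x, hx⟩
  let e : ℝ ≃ₜ ℝ := (hmono.orderIsoOfSurjective φ hsurj).toHomeomorph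
  have he : ∀ x, e x = φ x := fun x => rfl
  have hes : ∀ x, e.symm (φ x) = x := fun x => e.symm_apply_apply x
  have hd : ∀ y, HasDerivAt e.symm (w (e.symm y))⁻¹ y := fun y =>
    HasDerivAt.of_local_left_inverse e.symm.continuous.continuousAt (hφ _) (hw0 _).ne'
      (Filter.Eventually.of_forall fun z => e.apply_symm_apply z)
  have hG : ∀ y, HasDerivAt (fun y => g (e.symm y)) (g1 (e.symm y) * (w (e.symm y))⁻¹) y :=
    fun y => (hg _).comp y (hd y)
  have hgc : Continuous g := continuous_iff_continuousAt.2 fun x => (hg x).continuousAt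
  have cv : ∀ F : ℝ → ℝ, Continuous F → ∫ x in 0..2 * π, F x * w x =
      ∫ y in 0..2 * π, F (e.symm y) := fun F hF => by
    have := intervalIntegral.integral_comp_mul_deriv (a := 0) (b := 2 * π) (f := φ) (f' := w)
      (g := fun y => F (e.symm y)) (fun x _ => hφ x) hw.continuousOn
      (hF.comp e.symm.continuous)
    rw [hφ0, hφ1] at this
    rw [← this]
    simp only [Function.comp, hes]
  have hwi : Continuous fun x => (w x)⁻¹ := hw.inv₀ fun x => (hw0 x).ne'
  have key := integral_sq_le_integral_deriv_sq hG
    ((hg1.mul hwi).comp e.symm.continuous)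
    (by
      have h1 := hes (2 * π)
      have h0 := hes 0
      rw [hφ1] at h1
      rw [hφ0] at h0
      rw [h1, h0, hper])
    (by rw [← cv g hgc, hmean])
  rw [← cv (fun x => g x ^ 2) (by fun_prop),
    ← cv (fun x => (g1 x * (w x)⁻¹) ^ 2) (by fun_prop)] at key
  refine key.trans_eq ?_
  congr 1; ext x
  have := (hw0 x).ne'
  field_simp

/-- `f` is a `2π`-periodic `C²` function with first and second derivatives `f1` and `f2`. -/
structure IsPeriodicC2 (f f1 f2 : ℝ → ℝ) : Prop where
  hasDerivAt : ∀ x, HasDerivAt f (f1 x) x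
  hasDerivAt_deriv : ∀ x, HasDerivAt f1 (f2 x) x
  continuous_deriv2 : Continuous f2
  periodic : Function.Periodic f (2 * π)

namespace IsPeriodicC2

variable {f f1 f2 : ℝ → ℝ}

theorem continuous (hf : IsPeriodicC2 f f1 f2) : Continuous f :=
  continuous_iff_continuousAt.2 fun x => (hf.hasDerivAt x).continuousAt

theorem continuous_deriv (hf : IsPeriodicC2 f f1 f2) : Continuous f1 :=
  continuous_iff_continuousAt.2 fun x => (hf.hasDerivAt_deriv x).continuousAt

theorem periodic_deriv (hf : IsPeriodicC2 f f1 f2) : Function.Periodic f1 (2 * π) := fun x => by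
  have h := (hf.hasDerivAt (x + 2 * π)).comp_add_const x (2 * π)
  simp only [hf.periodic _] at h
  exact h.unique (hf.hasDerivAt x)

theorem periodic_deriv2 (hf : IsPeriodicC2 f f1 f2) : Function.Periodic f2 (2 * π) := fun x => by
  have h := (hf.hasDerivAt_deriv (x + 2 * π)).comp_add_const x (2 * π)
  simp only [hf.periodic_deriv _] at h
  exact h.unique (hf.hasDerivAt_deriv x)

theorem integral_mul_radius (hf : IsPeriodicC2 f f1 f2) :
    ∫ x in 0..2 * π, f x * (f2 x + f x) = ∫ x in 0..2 * π, (f x ^ 2 - f1 x ^ 2) := by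
  have hc := hf.continuous
  have hc1 := hf.continuous_deriv
  have hc2 := hf.continuous_deriv2
  have h := intervalIntegral.integral_eq_sub_of_hasDerivAt (a := 0) (b := 2 * π)
    (fun x _ => (hf.hasDerivAt x).mul (hf.hasDerivAt_deriv x))
    (Continuous.intervalIntegrable (by fun_prop) _ _)
  have e0 := hf.periodic 0
  have e1 := hf.periodic_deriv 0
  rw [zero_add] at e0 e1
  simp only [Pi.mul_apply, e0, e1, sub_self] at h
  rw [← sub_eq_zero, ← intervalIntegral.integral_sub, ← h]
  · congr 1; ext x; ring
  all_goals exact Continuous.intervalIntegrable (by fun_prop) _ _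

theorem integral_pos (hf : IsPeriodicC2 f f1 f2) (hr : ∀ x, 0 < f2 x + f x) :
    0 < ∫ x in 0..2 * π, f x := by
  have hc := hf.continuous
  have hc2 := hf.continuous_deriv2
  have h := intervalIntegral.integral_eq_sub_of_hasDerivAt (a := 0) (b := 2 * π)
    (fun x _ => hf.hasDerivAt_deriv x) (Continuous.intervalIntegrable (by fun_prop) _ _)
  have e1 := hf.periodic_deriv 0
  rw [zero_add] at e1
  rw [e1, sub_self] at h
  have hp : 0 < ∫ x in 0..2 * π, (f2 x + f x) :=
    intervalIntegral.intervalIntegral_pos_of_pos (Continuous.intervalIntegrable (by fun_prop) _ _)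
      hr (by positivity)
  rwa [intervalIntegral.integral_add, h, zero_add] at hp
  all_goals exact Continuous.intervalIntegrable (by fun_prop) _ _

/-- The support function dominates that of any boundary point. -/
theorem le_support (hf : IsPeriodicC2 f f1 f2) (hr : ∀ x, 0 < f2 x + f x) {x : ℝ}
    (hx : x ∈ Icc 0 (2 * π)) : f 0 * cos x + f1 0 * sin x ≤ f x := by
  let Φ : ℝ → ℝ := fun y => f y * cos (x - y) + f1 y * sin (x - y)
  have hΦ : ∀ y, HasDerivAt Φ ((f2 y + f y) * sin (x - y)) y := fun y => by
    have hs : HasDerivAt (fun y => x - y) (-1) y := by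
      simpa using (hasDerivAt_id y).const_sub x
    exact (((hf.hasDerivAt y).mul hs.cos).add ((hf.hasDerivAt_deriv y).mul hs.sin)).congr_deriv
      (by ring)
  have hΦc : Continuous Φ := continuous_iff_continuousAt.2 fun x => (hΦ x).continuousAt
  have hx' : Φ x = f x := by simp [Φ]
  rcases le_total x π with hxπ | hxπ
  · have : MonotoneOn Φ (Icc 0 x) := monotoneOn_of_hasDerivWithinAt_nonneg (convex_Icc _ _)
      hΦc.continuousOn (fun y _ => (hΦ y).hasDerivWithinAt) fun y hy => by
        rw [interior_Icc] at hy
        exact mul_nonneg (hr y).le (sin_nonneg_of_nonneg_of_le_pi (by linarith [hy.2])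
          (by linarith [hy.1]))
    have := this (left_mem_Icc.2 hx.1) (right_mem_Icc.2 hx.1) hx.1
    rw [hx'] at this
    simpa [Φ] using this
  · have : AntitoneOn Φ (Icc x (2 * π)) := antitoneOn_of_hasDerivWithinAt_nonpos (convex_Icc _ _)
      hΦc.continuousOn (fun y _ => (hΦ y).hasDerivWithinAt) fun y hy => by
        rw [interior_Icc] at hy
        exact mul_nonpos_of_nonneg_of_nonpos (hr y).le (sin_nonpos_of_nonpos_of_neg_pi_le
          (by linarith [hy.1]) (by linarith [hy.2]))
    have := this (left_mem_Icc.2 hx.2) (right_mem_Icc.2 hx.2) hx.2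
    have e0 := hf.periodic 0
    have e1 := hf.periodic_deriv 0
    rw [zero_add] at e0 e1
    rw [hx'] at this
    simpa [Φ, e0, e1, cos_sub_two_pi, sin_sub_two_pi] using this

theorem integral_radius_mul_cos (hf : IsPeriodicC2 f f1 f2) :
    ∫ x in 0..2 * π, (f2 x + f x) * cos x = 0 := by
  have hc := hf.continuous
  have hc2 := hf.continuous_deriv2
  have h := intervalIntegral.integral_eq_sub_of_hasDerivAt (a := 0) (b := 2 * π)
    (f := fun x => f1 x * cos x + f x * sin x) (f' := fun x => (f2 x + f x) * cos x)
    (fun x _ => (((hf.hasDerivAt_deriv x).mul (hasDerivAt_cos x)).add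
      ((hf.hasDerivAt x).mul (hasDerivAt_sin x))).congr_deriv (by ring))
    (Continuous.intervalIntegrable (by fun_prop) _ _)
  have e1 := hf.periodic_deriv 0
  rw [zero_add] at e1
  rw [h]; simp [e1]

theorem integral_radius_mul_sin (hf : IsPeriodicC2 f f1 f2) :
    ∫ x in 0..2 * π, (f2 x + f x) * sin x = 0 := by
  have hc := hf.continuous
  have hc2 := hf.continuous_deriv2
  have h := intervalIntegral.integral_eq_sub_of_hasDerivAt (a := 0) (b := 2 * π)
    (f := fun x => f1 x * sin x - f x * cos x) (f' := fun x => (f2 x + f x) * sin x)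
    (fun x _ => (((hf.hasDerivAt_deriv x).mul (hasDerivAt_sin x)).sub
      ((hf.hasDerivAt x).mul (hasDerivAt_cos x))).congr_deriv (by ring))
    (Continuous.intervalIntegrable (by fun_prop) _ _)
  have e0 := hf.periodic 0
  rw [zero_add] at e0
  rw [h]; simp [e0]

/-- The enclosed area is nonnegative. -/
theorem integral_deriv_sq_sub_sq_nonpos (hf : IsPeriodicC2 f f1 f2)
    (hr : ∀ x, 0 < f2 x + f x) : ∫ x in 0..2 * π, (f1 x ^ 2 - f x ^ 2) ≤ 0 := by
  have hc := hf.continuous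
  have hc2 := hf.continuous_deriv2
  have h : 0 ≤ ∫ x in 0..2 * π, (f x * (f2 x + f x) - f 0 * ((f2 x + f x) * cos x)) -
      f1 0 * ((f2 x + f x) * sin x) :=
    intervalIntegral.integral_nonneg (by positivity) fun x hx => by
      nlinarith [mul_nonneg (hr x).le (sub_nonneg.2 (hf.le_support hr hx))]
  rw [intervalIntegral.integral_sub, intervalIntegral.integral_sub,
    intervalIntegral.integral_const_mul, intervalIntegral.integral_const_mul,
    hf.integral_radius_mul_cos, hf.integral_radius_mul_sin, hf.integral_mul_radius] at h
  · have : ∫ x in 0..2 * π, (f1 x ^ 2 - f x ^ 2) = -∫ x in 0..2 * π, (f x ^ 2 - f1 x ^ 2) := by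
      rw [← intervalIntegral.integral_neg]
      congr 1; ext x; ring
    linarith
  all_goals exact Continuous.intervalIntegrable (by fun_prop) _ _

/-- A reverse Cauchy-Schwarz inequality for the form `∫ g'² - g²`, which is Lorentzian on the
circle. -/
theorem integral_deriv_sq_sub_sq_nonneg (hf : IsPeriodicC2 f f1 f2)
    (hr : ∀ x, 0 < f2 x + f x) {g g1 : ℝ → ℝ} (hg : ∀ x, HasDerivAt g (g1 x) x)
    (hg1 : Continuous g1) (hper : g (2 * π) = g 0)
    (horth : ∫ x in 0..2 * π, (f2 x + f x) * g x = 0) :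
    0 ≤ ∫ x in 0..2 * π, (g1 x ^ 2 - g x ^ 2) := by
  have hc := hf.continuous
  have hc1 := hf.continuous_deriv
  have hc2 := hf.continuous_deriv2
  have hgc : Continuous g := continuous_iff_continuousAt.2 fun x => (hg x).continuousAt
  have e0 := hf.periodic 0
  have e1 := hf.periodic_deriv 0
  rw [zero_add] at e0 e1
  have hpair : ∫ x in 0..2 * π, (f1 x * g1 x - f x * g x) = 0 := by
    have h := intervalIntegral.integral_eq_sub_of_hasDerivAt (a := 0) (b := 2 * π)
      (fun x _ => (hf.hasDerivAt_deriv x).mul (hg x))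
      (Continuous.intervalIntegrable (by fun_prop) _ _)
    simp only [Pi.mul_apply, e1, hper, sub_self] at h
    have e : ∫ x in 0..2 * π, (f1 x * g1 x - f x * g x) =
        ∫ x in 0..2 * π, ((f2 x * g x + f1 x * g1 x) - (f2 x + f x) * g x) := by
      congr 1; ext x; ring
    rw [e, intervalIntegral.integral_sub, h, horth, sub_zero]
    all_goals exact Continuous.intervalIntegrable (by fun_prop) _ _
  have hI := hf.integral_pos hr
  have hq := hf.integral_deriv_sq_sub_sq_nonpos hr
  obtain ⟨a, ha⟩ : ∃ a, a * ∫ x in 0..2 * π, f x = ∫ x in 0..2 * π, g x :=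
    ⟨_, div_mul_cancel₀ _ hI.ne'⟩
  have hW := integral_sq_le_integral_deriv_sq (g := fun x => g x - a * f x)
    (g1 := fun x => g1 x - a * f1 x) (fun x => (hg x).sub ((hf.hasDerivAt x).const_mul a))
    (by fun_prop) (by simp only [hper, e0]) (by
      rw [intervalIntegral.integral_sub, intervalIntegral.integral_const_mul, ha, sub_self]
      all_goals exact Continuous.intervalIntegrable (by fun_prop) _ _)
  rw [← sub_nonneg, ← intervalIntegral.integral_sub] at hW
  · have e : ∫ x in 0..2 * π, ((g1 x - a * f1 x) ^ 2 - (g x - a * f x) ^ 2) =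
        ∫ x in 0..2 * π, ((g1 x ^ 2 - g x ^ 2) - 2 * a * (f1 x * g1 x - f x * g x)) +
          a ^ 2 * (f1 x ^ 2 - f x ^ 2) := by
      congr 1; ext x; ring
    rw [e, intervalIntegral.integral_add, intervalIntegral.integral_sub,
      intervalIntegral.integral_const_mul, intervalIntegral.integral_const_mul, hpair] at hW
    · nlinarith [mul_nonneg (sq_nonneg a) (neg_nonneg.2 hq)]
    all_goals exact Continuous.intervalIntegrable (by fun_prop) _ _
  all_goals exact Continuous.intervalIntegrable (by fun_prop) _ _

end IsPeriodicC2

/-- A reparametrisation of the circle proportional to a given density. -/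
theorem exists_reparametrization {w : ℝ → ℝ} (hw : Continuous w) {L : ℝ} (hL0 : 0 < L)
    (hL : L = ∫ x in 0..2 * π, w x) : ∃ φ : ℝ → ℝ, φ 0 = 0 ∧ φ (2 * π) = 2 * π ∧
      ∀ x, HasDerivAt φ (2 * π / L * w x) x := by
  refine ⟨fun x => 2 * π / L * ∫ y in 0..x, w y, by simp, ?_, fun x =>
    (intervalIntegral.integral_hasDerivAt_right (hw.intervalIntegrable _ _)
      (hw.stronglyMeasurableAtFilter _ _) hw.continuousAt).const_mul _⟩
  simp only [← hL]
  field_simp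

/-- The Santaló-type bound: the product of the affine length and the total affine curvature is at
most `4π²`. -/
theorem affineLength_mul_totalCurvature_le {h h1 h2 v v1 v2 : ℝ → ℝ} (hh : IsPeriodicC2 h h1 h2)
    (hv : IsPeriodicC2 v v1 v2) (hv0 : ∀ x, 0 < v x) (hr : ∀ x, (h2 x + h x) * v x ^ 3 = 1)
    {L M : ℝ} (hL : L = ∫ x in 0..2 * π, (v x ^ 2)⁻¹)
    (hM : M = ∫ x in 0..2 * π, v x * (v2 x + v x)) : L * M ≤ 4 * π ^ 2 := by
  have hvc := hv.continuous
  have hv1c := hv.continuous_deriv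
  have hr0 : ∀ x, 0 < h2 x + h x := fun x =>
    pos_of_mul_pos_left (by rw [hr x]; exact one_pos) (pow_pos (hv0 x) 3).le
  have hw : Continuous fun x => (v x ^ 2)⁻¹ :=
    (hvc.pow 2).inv₀ fun x => (pow_pos (hv0 x) 2).ne'
  have hvi : Continuous fun x => (v x)⁻¹ := hvc.inv₀ fun x => (hv0 x).ne'
  have hL0 : 0 < L := by
    rw [hL]
    exact intervalIntegral.intervalIntegral_pos_of_pos (hw.intervalIntegrable _ _)
      (fun x => inv_pos.2 (pow_pos (hv0 x) 2)) (by positivity)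
  obtain ⟨φ, hφ0, hφ1, hφ⟩ := exists_reparametrization hw hL0 hL
  have hφc : Continuous φ := continuous_iff_continuousAt.2 fun x => (hφ x).continuousAt
  have e0 := hv.periodic 0
  rw [zero_add] at e0
  set k := 2 * π / L with hk
  have hk0 : 0 < k := by positivity
  have hrv : ∀ x, (h2 x + h x) * v x = (v x ^ 2)⁻¹ := fun x => by
    rw [← mul_eq_one_iff_eq_inv₀ (pow_pos (hv0 x) 2).ne', ← hr x]; ring
  have kv : ∀ x, k * (v x ^ 2)⁻¹ * v x = k * (v x)⁻¹ := fun x => by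
    have := (hv0 x).ne'
    field_simp
  have A := hh.integral_deriv_sq_sub_sq_nonneg hr0 (g := fun x => v x * cos (φ x))
    (g1 := fun x => v1 x * cos (φ x) - k * (v x)⁻¹ * sin (φ x))
    (fun x => ((hv.hasDerivAt x).mul (hφ x).cos).congr_deriv (by rw [← kv x]; ring))
    (by fun_prop) (by simp [hφ0, hφ1, e0])
    (by
      have := intervalIntegral.integral_eq_sub_of_hasDerivAt (a := 0) (b := 2 * π)
        (fun x _ => (hφ x).sin) (Continuous.intervalIntegrable (by fun_prop) _ _)
      rw [hφ0, hφ1, sin_two_pi, sin_zero, sub_zero] at this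
      rw [← mul_right_inj' hk0.ne', mul_zero, ← intervalIntegral.integral_const_mul, ← this]
      congr 1; ext x
      linear_combination k * cos (φ x) * hrv x)
  have B := hh.integral_deriv_sq_sub_sq_nonneg hr0 (g := fun x => v x * sin (φ x))
    (g1 := fun x => v1 x * sin (φ x) + k * (v x)⁻¹ * cos (φ x))
    (fun x => ((hv.hasDerivAt x).mul (hφ x).sin).congr_deriv (by rw [← kv x]; ring))
    (by fun_prop) (by simp [hφ0, hφ1, e0])
    (by
      have := intervalIntegral.integral_eq_sub_of_hasDerivAt (a := 0) (b := 2 * π)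
        (fun x _ => (hφ x).cos) (Continuous.intervalIntegrable (by fun_prop) _ _)
      rw [hφ0, hφ1, cos_two_pi, cos_zero, sub_self] at this
      rw [← mul_right_inj' (neg_ne_zero.2 hk0.ne'), mul_zero,
        ← intervalIntegral.integral_const_mul, ← this]
      congr 1; ext x
      linear_combination -k * sin (φ x) * hrv x)
  have S := add_nonneg A B
  rw [← intervalIntegral.integral_add] at S
  · have e : ∫ x in 0..2 * π, ((v1 x * cos (φ x) - k * (v x)⁻¹ * sin (φ x)) ^ 2 -
          (v x * cos (φ x)) ^ 2 + ((v1 x * sin (φ x) + k * (v x)⁻¹ * cos (φ x)) ^ 2 -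
          (v x * sin (φ x)) ^ 2)) =
        ∫ x in 0..2 * π, (k ^ 2 * (v x ^ 2)⁻¹ - (v x ^ 2 - v1 x ^ 2)) := by
      congr 1; ext x
      rw [← inv_pow]
      linear_combination (v1 x ^ 2 + k ^ 2 * (v x)⁻¹ ^ 2 - v x ^ 2) * sin_sq_add_cos_sq (φ x)
    rw [e, intervalIntegral.integral_sub, intervalIntegral.integral_const_mul, ← hL,
      ← hv.integral_mul_radius, ← hM] at S
    · have hkL : k * L = 2 * π := by rw [hk]; field_simp
      have : L * (k ^ 2 * L) = 4 * π ^ 2 := by linear_combination (k * L + 2 * π) * hkL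
      nlinarith
    all_goals exact Continuous.intervalIntegrable (by fun_prop) _ _
  all_goals exact Continuous.intervalIntegrable (by fun_prop) _ _

/-- The variance of the affine curvature `v³(v'' + v)` with respect to affine arclength. -/
theorem integral_affineCurvature_variance {v v1 v2 : ℝ → ℝ} (hv : IsPeriodicC2 v v1 v2)
    (hv0 : ∀ x, 0 < v x) {L M N : ℝ} (hL : L = ∫ x in 0..2 * π, (v x ^ 2)⁻¹)
    (hM : M = ∫ x in 0..2 * π, v x * (v2 x + v x))
    (hN : N = ∫ x in 0..2 * π, v x ^ 4 * (v2 x + v x) ^ 2) (hL0 : 0 < L) :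
    ∫ x in 0..2 * π, ((v x ^ 3 * (v2 x + v x) - M / L) * (v x)⁻¹) ^ 2 = N - M ^ 2 / L := by
  have hvc := hv.continuous
  have hv2c := hv.continuous_deriv2
  have hw : Continuous fun x => (v x ^ 2)⁻¹ :=
    (hvc.pow 2).inv₀ fun x => (pow_pos (hv0 x) 2).ne'
  have e : ∫ x in 0..2 * π, ((v x ^ 3 * (v2 x + v x) - M / L) * (v x)⁻¹) ^ 2 =
      ∫ x in 0..2 * π, (v x ^ 4 * (v2 x + v x) ^ 2 - 2 * (M / L) * (v x * (v2 x + v x))) +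
        (M / L) ^ 2 * (v x ^ 2)⁻¹ := by
    congr 1; ext x
    have := (hv0 x).ne'
    field_simp
    ring
  rw [e, intervalIntegral.integral_add, intervalIntegral.integral_sub,
    intervalIntegral.integral_const_mul, intervalIntegral.integral_const_mul, ← hL, ← hM, ← hN]
  · field_simp
    ring
  all_goals exact Continuous.intervalIntegrable (by fun_prop) _ _

theorem sq_le_of_hasDerivAt {x x1 v : ℝ → ℝ} (hx : ∀ y, HasDerivAt x (x1 y) y)
    (hx1 : Continuous x1) (hv : Continuous v) (hv0 : ∀ y, 0 < v y) {a y b : ℝ} (ha : x a = 0)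
    (ha' : a ∈ Icc 0 b) (hy : y ∈ Icc 0 b) :
    x y ^ 2 ≤ (∫ z in 0..b, (v z ^ 2)⁻¹) * ∫ z in 0..b, (x1 z * v z) ^ 2 := by
  have hb : 0 ≤ b := ha'.1.trans ha'.2
  have hvi : Continuous fun x => (v x)⁻¹ := hv.inv₀ fun x => (hv0 x).ne'
  have hval : x y = ∫ z in a..y, x1 z := by
    rw [intervalIntegral.integral_eq_sub_of_hasDerivAt (fun z _ => hx z)
      (hx1.intervalIntegrable _ _), ha, sub_zero]
  have hle : |x y| ≤ ∫ z in 0..b, |x1 z| := by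
    rw [hval]
    refine (intervalIntegral.norm_integral_le_abs_integral_norm (f := x1)).trans ?_
    refine (intervalIntegral.abs_integral_mono_interval ?_
      (Filter.Eventually.of_forall fun z => abs_nonneg _)
      (hx1.abs.intervalIntegrable 0 b)).trans_eq ?_
    · rw [uIoc_of_le hb]
      exact Ioc_subset_Ioc (le_min ha'.1 hy.1) (max_le ha'.2 hy.2)
    · exact abs_of_nonneg (intervalIntegral.integral_nonneg hb fun z _ => abs_nonneg _)
  have hcs := sq_integral_mul_le (f := fun z => (v z)⁻¹) (g := fun z => |x1 z * v z|) hvi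
    (by fun_prop) hb
  simp only [inv_pow, sq_abs] at hcs
  refine le_trans ?_ hcs
  have e : (fun z => (v z)⁻¹ * |x1 z * v z|) = fun z => |x1 z| := by
    ext z
    have := (hv0 z).ne'
    rw [abs_mul, abs_of_pos (hv0 z)]
    field_simp
  rw [e, ← sq_abs (x y)]
  gcongr

/-- Quantitative stability: small variance of the affine curvature forces the product of the
affine length and the total affine curvature to be close to `4π²`. -/
theorem sq_one_sub_le_variance {h h1 h2 v v1 v2 : ℝ → ℝ} (hh : IsPeriodicC2 h h1 h2)
    (hv : IsPeriodicC2 v v1 v2) (hv0 : ∀ x, 0 < v x) (hr : ∀ x, (h2 x + h x) * v x ^ 3 = 1)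
    {L M N : ℝ} (hL : L = ∫ x in 0..2 * π, (v x ^ 2)⁻¹)
    (hM : M = ∫ x in 0..2 * π, v x * (v2 x + v x))
    (hN : N = ∫ x in 0..2 * π, v x ^ 4 * (v2 x + v x) ^ 2) (hL0 : 0 < L) (hM0 : 0 ≤ M) :
    (1 - L * M / (4 * π ^ 2)) ^ 2 ≤ (N - M ^ 2 / L) * L ^ 3 / (4 * π ^ 2) := by
  have hLM := affineLength_mul_totalCurvature_le hh hv hv0 hr hL hM
  have hvc := hv.continuous
  have hv1c := hv.continuous_deriv
  have hv2c := hv.continuous_deriv2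
  have hvne : ∀ x, v x ≠ 0 := fun x => (hv0 x).ne'
  have hw : Continuous fun x => (v x ^ 2)⁻¹ :=
    (hvc.pow 2).inv₀ fun x => (pow_pos (hv0 x) 2).ne'
  have hvi : Continuous fun x => (v x)⁻¹ := hvc.inv₀ hvne
  obtain ⟨φ, hφ0, hφ1, hφ⟩ := exists_reparametrization hw hL0 hL
  have e0 := hv.periodic 0
  have e1 := hv.periodic_deriv 0
  rw [zero_add] at e0 e1
  set k := 2 * π / L with hk
  have hk0 : 0 < k := by positivity
  set x : ℝ → ℝ := fun y => cos y * (v y)⁻¹ with hx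
  set x1 : ℝ → ℝ := fun y => -sin y * (v y)⁻¹ - cos y * v1 y * (v y ^ 2)⁻¹ with hx1
  have hxd : ∀ y, HasDerivAt x (x1 y) y := fun y =>
    ((hasDerivAt_cos y).mul ((hv.hasDerivAt y).inv (hvne y))).congr_deriv (by
      simp only [hx1, Pi.inv_apply]; ring)
  have hxc : Continuous x := by fun_prop
  have hx1c : Continuous x1 := by fun_prop
  have hW := integral_sq_mul_le_integral_deriv_sq_div hxd hx1c (by simp [hx, e0]) hφ (by fun_prop)
    (fun y => mul_pos hk0 (inv_pos.2 (pow_pos (hv0 y) 2))) (fun y => by simp only [hv.periodic y])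
    hφ0 hφ1 (by
      have e : ∀ y, x y * (k * (v y ^ 2)⁻¹) = k * ((h2 y + h y) * cos y) := fun y => by
        have := hvne y
        rw [eq_div_of_mul_eq (pow_ne_zero 3 this) (hr y)]
        simp only [hx]
        field_simp
      simp only [e]
      rw [intervalIntegral.integral_const_mul, hh.integral_radius_mul_cos, mul_zero])
  set E := ∫ y in 0..2 * π, (x1 y * v y) ^ 2 with hE
  set X := ∫ y in 0..2 * π, (x y * (v y)⁻¹) ^ 2 with hX
  have hW' : k * X ≤ E / k := by
    convert hW using 1
    · rw [hX, ← intervalIntegral.integral_const_mul]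
      congr 1; ext y; ring
    · rw [hE, ← intervalIntegral.integral_div]
      congr 1; ext y
      have := hvne y
      field_simp
  have hkX : k ^ 2 * X ≤ E := by
    rw [le_div_iff₀ hk0] at hW'
    linarith
  have hEpos : 0 < E := by
    refine lt_of_lt_of_le (mul_pos (pow_pos hk0 2) ?_) hkX
    refine intervalIntegral.integral_pos (by positivity)
      (Continuous.continuousOn (by fun_prop)) (fun _ _ => sq_nonneg _) ⟨0, by simp [pi_pos.le], ?_⟩
    have := hvne 0
    simp only [hx, cos_zero]
    positivity
  have hXnn : 0 ≤ X := intervalIntegral.integral_nonneg (by positivity) fun _ _ => sq_nonneg _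
  -- the Hill equation `x_ss + μ x = 0`, tested against `x`
  have hHill : E = ∫ y in 0..2 * π, (v2 y + v y) * v y * x y ^ 2 := by
    have hd := intervalIntegral.integral_eq_sub_of_hasDerivAt (a := 0) (b := 2 * π)
      (f := fun y => cos y * (x1 y * v y)) (f' := fun y =>
        (x1 y * v y) ^ 2 - (v2 y + v y) * v y * x y ^ 2)
      (fun y _ => by
        have hxv : HasDerivAt (fun y => -sin y - cos y * v1 y * (v y)⁻¹)
            (-cos y - ((-sin y * v1 y + cos y * v2 y) * (v y)⁻¹ +
              cos y * v1 y * (-v1 y / v y ^ 2))) y :=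
          (hasDerivAt_sin y).neg.sub (((hasDerivAt_cos y).mul (hv.hasDerivAt_deriv y)).mul
            ((hv.hasDerivAt y).inv (hvne y)))
        have e : (fun y => cos y * (x1 y * v y)) =
            fun y => cos y * (-sin y - cos y * v1 y * (v y)⁻¹) := by
          ext z
          have := hvne z
          simp only [hx1]
          field_simp
        rw [e]
        refine ((hasDerivAt_cos y).mul hxv).congr_deriv ?_
        have := hvne y
        simp only [hx1, hx]
        field_simp
        ring) (Continuous.intervalIntegrable (by fun_prop) _ _)
    have hz : cos (2 * π) * (x1 (2 * π) * v (2 * π)) - cos 0 * (x1 0 * v 0) = 0 := by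
      simp [hx1, e0, e1]
    rw [hz, intervalIntegral.integral_sub, sub_eq_zero] at hd
    · exact hd
    all_goals exact Continuous.intervalIntegrable (by fun_prop) _ _
  have hvar := integral_affineCurvature_variance hv hv0 hL hM hN hL0
  set D := N - M ^ 2 / L with hD
  set F : ℝ → ℝ := fun y => (v y ^ 3 * (v2 y + v y) - M / L) * (v y)⁻¹ with hF
  have hFc : Continuous F := by fun_prop
  set G : ℝ → ℝ := fun y => x y ^ 2 * (v y)⁻¹ with hG
  have hGc : Continuous G := by fun_prop
  have hJ : ∫ y in 0..2 * π, F y * G y = E - M / L * X := by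
    rw [hHill, hX, ← intervalIntegral.integral_const_mul, ← intervalIntegral.integral_sub]
    · congr 1; ext y
      have := hvne y
      simp only [hF, hG]
      field_simp
    all_goals exact Continuous.intervalIntegrable (by fun_prop) _ _
  have hCS := sq_integral_mul_le hFc hGc (show (0 : ℝ) ≤ 2 * π by positivity)
  rw [hJ, hvar] at hCS
  have hDnn : 0 ≤ D := by
    rw [← hvar]
    exact intervalIntegral.integral_nonneg (by positivity) fun _ _ => sq_nonneg _
  have hGle : ∫ y in 0..2 * π, G y ^ 2 ≤ L * E * X := by
    rw [hX, ← intervalIntegral.integral_const_mul]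
    refine intervalIntegral.integral_mono_on (by positivity)
      (Continuous.intervalIntegrable (by fun_prop) _ _)
      (Continuous.intervalIntegrable (by fun_prop) _ _) fun y hy => ?_
    have := sq_le_of_hasDerivAt hxd hx1c hvc hv0 (a := π / 2) (by simp [hx])
      ⟨by positivity, by linarith [pi_pos]⟩ hy
    rw [← hL, ← hE] at this
    calc G y ^ 2 = x y ^ 2 * (x y * (v y)⁻¹) ^ 2 := by simp only [hG]; ring
      _ ≤ _ := by gcongr
  have hm : M / L = L * M / (4 * π ^ 2) * k ^ 2 := by
    rw [hk]; field_simp; norm_num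
  set q := L * M / (4 * π ^ 2) with hq
  have hq1 : q ≤ 1 := by rw [hq, div_le_one (by positivity)]; exact hLM
  have hq0 : 0 ≤ q := by positivity
  have hlow : (1 - q) * E ≤ E - M / L * X := by
    rw [hm]; nlinarith [mul_le_mul_of_nonneg_left hkX hq0]
  have hfin : ((1 - q) * E) ^ 2 ≤ D * (L * E * (E / k ^ 2)) :=
    calc ((1 - q) * E) ^ 2 ≤ (E - M / L * X) ^ 2 := by
          gcongr
      _ ≤ D * ∫ y in 0..2 * π, G y ^ 2 := hCS
      _ ≤ D * (L * E * X) := by gcongr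
      _ ≤ _ := by
          gcongr
          rw [le_div_iff₀ (by positivity)]
          linarith
  have hk2 : D * (L * E * (E / k ^ 2)) = D * L ^ 3 / (4 * π ^ 2) * E ^ 2 := by
    rw [hk]; field_simp; ring
  rw [hk2, mul_pow] at hfin
  exact le_of_mul_le_mul_right hfin (by positivity)

/-- If the affine curvature has zero variance, it is constant. -/
theorem affineCurvature_eq_of_variance_eq_zero {v v1 v2 : ℝ → ℝ} (hv : IsPeriodicC2 v v1 v2)
    (hv0 : ∀ x, 0 < v x) {L M N : ℝ} (hL : L = ∫ x in 0..2 * π, (v x ^ 2)⁻¹)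
    (hM : M = ∫ x in 0..2 * π, v x * (v2 x + v x))
    (hN : N = ∫ x in 0..2 * π, v x ^ 4 * (v2 x + v x) ^ 2) (hL0 : 0 < L)
    (h0 : N - M ^ 2 / L = 0) (x : ℝ) : v x ^ 3 * (v2 x + v x) = M / L := by
  have hvc := hv.continuous
  have hv2c := hv.continuous_deriv2
  have hvi : Continuous fun x => (v x)⁻¹ := hvc.inv₀ fun x => (hv0 x).ne'
  have hP : Function.Periodic (fun x => v x ^ 3 * (v2 x + v x)) (2 * π) := fun x => by
    simp only [hv.periodic x, hv.periodic_deriv2 x]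
  obtain ⟨y, hy, hxy⟩ := hP.exists_mem_Ico₀ (by positivity) x
  rw [show v x ^ 3 * (v2 x + v x) = v y ^ 3 * (v2 y + v y) from hxy]
  by_contra hne
  refine (intervalIntegral.integral_pos (show (0 : ℝ) < 2 * π by positivity)
    (f := fun x => ((v x ^ 3 * (v2 x + v x) - M / L) * (v x)⁻¹) ^ 2)
    (Continuous.continuousOn (by fun_prop)) (fun _ _ => sq_nonneg _)
    ⟨y, Ico_subset_Icc_self hy, ?_⟩).ne' ?_
  · have := (hv0 y).ne'
    have := sub_ne_zero.2 hne
    positivity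
  · rw [integral_affineCurvature_variance hv hv0 hL hM hN hL0, h0]

/-- An ancient solution of the evolution inequalities for the affine length `L` and the total affine
curvature `M` has constant `L * M`. -/
theorem mul_eq_of_ancient {T Y C : ℝ} {L M N : ℝ → ℝ} (hY : 0 < Y) (hC : 0 < C)
    (hL : ∀ t < T, HasDerivAt L (-(2 / 3) * M t) t) (hM : ∀ t < T, HasDerivAt M (2 / 3 * N t) t)
    (hL0 : ∀ t < T, 0 < L t) (hN0 : ∀ t < T, 0 ≤ N t - M t ^ 2 / L t)
    (hLM : ∀ t < T, L t * M t ≤ Y)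
    (hstab : ∀ t < T, 0 ≤ M t → (1 - L t * M t / Y) ^ 2 ≤ (N t - M t ^ 2 / L t) * L t ^ 3 / C) :
    ∀ t < T, L t * M t = Y := by
  have mono : ∀ {f f' : ℝ → ℝ} {t₀ : ℝ}, (∀ t ≤ t₀, HasDerivAt f (f' t) t) →
      (∀ t ≤ t₀, 0 ≤ f' t) → ∀ t ≤ t₀, f t ≤ f t₀ := fun {f f' t₀} hf hf' t ht =>
    monotoneOn_of_hasDerivWithinAt_nonneg (convex_Iic t₀)
      (fun s hs => (hf s hs).continuousAt.continuousWithinAt)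
      (fun s hs => (hf s (mem_Iic.1 (interior_subset hs))).hasDerivWithinAt)
      (fun s hs => hf' s (mem_Iic.1 (interior_subset hs))) (mem_Iic.2 ht) (mem_Iic.2 le_rfl) ht
  have hNnn : ∀ t < T, 0 ≤ N t := fun t ht => by
    have := div_nonneg (sq_nonneg (M t)) (hL0 t ht).le
    linarith [hN0 t ht]
  have hMnn : ∀ t < T, 0 ≤ M t := by
    intro t₀ ht₀
    by_contra! hneg
    have hMle : ∀ t ≤ t₀, M t ≤ M t₀ := mono (fun t ht => hM t (ht.trans_lt ht₀)) fun t ht =>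
      mul_nonneg (by norm_num) (hNnn t (ht.trans_lt ht₀))
    have hLle := mono (f := fun t => L t + 2 / 3 * M t₀ * t)
      (f' := fun t => -(2 / 3) * M t + 2 / 3 * M t₀)
      (fun t ht => ((hL t (ht.trans_lt ht₀)).add
        ((hasDerivAt_id t).const_mul (2 / 3 * M t₀))).congr_deriv (by simp))
      fun t ht => by linarith [hMle t ht]
    have hpos : 0 < -(2 / 3 * M t₀) := by linarith
    have h1 := hLle (t₀ - L t₀ / (-(2 / 3 * M t₀)))
      (by linarith [div_pos (hL0 t₀ ht₀) hpos])
    have h2 := hL0 (t₀ - L t₀ / (-(2 / 3 * M t₀)))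
      (by linarith [div_pos (hL0 t₀ ht₀) hpos])
    have h3 : 2 / 3 * M t₀ * (L t₀ / (-(2 / 3 * M t₀))) = -L t₀ := by
      have := hneg.ne
      field_simp
    nlinarith
  intro t₀ ht₀
  refine le_antisymm (hLM t₀ ht₀) ?_
  by_contra! hlt
  have hy : ∀ t < T, HasDerivAt (fun t => L t * M t)
      (2 / 3 * (L t * (N t - M t ^ 2 / L t))) t := fun t ht =>
    ((hL t ht).mul (hM t ht)).congr_deriv (by
      have := (hL0 t ht).ne'
      field_simp
      ring)
  have hy0 : ∀ t < T, 0 ≤ 2 / 3 * (L t * (N t - M t ^ 2 / L t)) := fun t ht =>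
    mul_nonneg (by norm_num) (mul_nonneg (hL0 t ht).le (hN0 t ht))
  have hyle : ∀ t ≤ t₀, L t * M t ≤ L t₀ * M t₀ :=
    mono (fun t ht => hy t (ht.trans_lt ht₀)) fun t ht => hy0 t (ht.trans_lt ht₀)
  have hL2 : ∀ t ≤ t₀, L t ^ 2 ≤ L t₀ ^ 2 + 4 / 3 * Y * (t₀ - t) := by
    intro t ht
    have := mono (f := fun t => L t ^ 2 + 4 / 3 * Y * t)
      (f' := fun t => 2 * L t * (-(2 / 3) * M t) + 4 / 3 * Y) (t₀ := t₀)
      (fun t ht => (((hL t (ht.trans_lt ht₀)).pow 2).add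
        ((hasDerivAt_id t).const_mul (4 / 3 * Y))).congr_deriv (by simp))
      (fun t ht => by linarith [hLM t (ht.trans_lt ht₀)]) t ht
    linarith
  set δ := 1 - L t₀ * M t₀ / Y with hδ
  have hδ0 : 0 < δ := by rw [hδ, sub_pos, div_lt_one hY]; exact hlt
  set c := 2 / 3 * (δ ^ 2 * C) with hc
  have hc0 : 0 < c := by positivity
  have hy1 : ∀ t ≤ t₀, c / (L t₀ ^ 2 + 4 / 3 * Y * (t₀ - t)) ≤
      2 / 3 * (L t * (N t - M t ^ 2 / L t)) := by
    intro t ht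
    have htT := ht.trans_lt ht₀
    have hLt := hL0 t htT
    have h1 : δ ^ 2 ≤ (N t - M t ^ 2 / L t) * L t ^ 3 / C := by
      refine le_trans ?_ (hstab t htT (hMnn t htT))
      have : L t * M t / Y ≤ L t₀ * M t₀ / Y :=
        div_le_div_of_nonneg_right (hyle t ht) hY.le
      gcongr
      rw [hδ]; linarith
    rw [le_div_iff₀ hC] at h1
    calc c / (L t₀ ^ 2 + 4 / 3 * Y * (t₀ - t)) ≤ c / L t ^ 2 := by
          gcongr; exact hL2 t ht
      _ ≤ _ := by
          rw [div_le_iff₀ (by positivity)]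
          rw [hc]; nlinarith
  have hq : ∀ t ≤ t₀, 0 < L t₀ ^ 2 + 4 / 3 * Y * (t₀ - t) := fun t ht =>
    (pow_pos (hL0 t (ht.trans_lt ht₀)) 2).trans_le (hL2 t ht)
  set b := c / (4 / 3 * Y) with hb
  have hb0 : 0 < b := by positivity
  have hΦ := mono (f := fun t => L t * M t + b * log (L t₀ ^ 2 + 4 / 3 * Y * (t₀ - t)))
    (f' := fun t => 2 / 3 * (L t * (N t - M t ^ 2 / L t)) +
      b * (-(4 / 3 * Y) / (L t₀ ^ 2 + 4 / 3 * Y * (t₀ - t))))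
    (t₀ := t₀)
    (fun t ht => (hy t (ht.trans_lt ht₀)).add (((((hasDerivAt_id t).const_sub t₀).const_mul
      (4 / 3 * Y)).const_add (L t₀ ^ 2)).log (hq t ht).ne' |>.const_mul b |>.congr_deriv (by simp)))
    (fun t ht => by
      have h1 := hy1 t ht
      have h2 : b * (-(4 / 3 * Y) / (L t₀ ^ 2 + 4 / 3 * Y * (t₀ - t))) =
        -(c / (L t₀ ^ 2 + 4 / 3 * Y * (t₀ - t))) := by
        rw [hb]; field_simp
      linarith)
  set K := L t₀ * M t₀ + b * log (L t₀ ^ 2 + 4 / 3 * Y * (t₀ - t₀)) with hK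
  -- the logarithm is unbounded as `t → -∞`
  obtain ⟨t, ht, hlog⟩ : ∃ t ≤ t₀, K < b * log (L t₀ ^ 2 + 4 / 3 * Y * (t₀ - t)) := by
    refine ⟨t₀ - exp (K / b + 1) / (4 / 3 * Y), by simp only [sub_le_self_iff]; positivity, ?_⟩
    rw [← div_lt_iff₀' hb0, Real.lt_log_iff_exp_lt (hq _ (by
      simp only [sub_le_self_iff]; positivity))]
    have e : 4 / 3 * Y * (t₀ - (t₀ - exp (K / b + 1) / (4 / 3 * Y))) = exp (K / b + 1) := by
      field_simp; ring
    rw [e]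
    have : exp (K / b) < exp (K / b + 1) := exp_lt_exp.2 (by linarith)
    nlinarith [sq_nonneg (L t₀)]
  have h1 := hΦ t ht
  have h2 := mul_nonneg (hL0 t (ht.trans_lt ht₀)).le (hMnn t (ht.trans_lt ht₀))
  linarith


/-- Smoothness of a function of `(θ, t)` on `ℝ × (-∞, T)`. -/
def SmoothBefore (T : ℝ) (F : ℝ → ℝ → ℝ) : Prop :=
  ContDiffOn ℝ (⊤ : ℕ∞) (fun p : ℝ × ℝ => F p.1 p.2) (univ ×ˢ Iio T)

/-- The partial derivative in the angle. -/
def angleDeriv (F : ℝ → ℝ → ℝ) (θ t : ℝ) : ℝ := deriv (fun x => F x t) θ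

/-- The partial derivative in time. -/
def timeDeriv (F : ℝ → ℝ → ℝ) (θ t : ℝ) : ℝ := deriv (fun s => F θ s) t

namespace SmoothBefore

variable {T : ℝ} {F G : ℝ → ℝ → ℝ} {θ t : ℝ}

theorem contDiffAt (hF : SmoothBefore T F) (ht : t < T) :
    ContDiffAt ℝ (⊤ : ℕ∞) (fun p : ℝ × ℝ => F p.1 p.2) (θ, t) :=
  ContDiffOn.contDiffAt hF ((isOpen_univ.prod isOpen_Iio).mem_nhds ⟨mem_univ _, ht⟩)

theorem hasFDerivAt (hF : SmoothBefore T F) (ht : t < T) :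
    HasFDerivAt (fun p : ℝ × ℝ => F p.1 p.2) (fderiv ℝ (fun p : ℝ × ℝ => F p.1 p.2) (θ, t))
      (θ, t) :=
  ((hF.contDiffAt ht).differentiableAt (by simp)).hasFDerivAt

theorem hasDerivAt_angle_fderiv (hF : SmoothBefore T F) (ht : t < T) :
    HasDerivAt (fun x => F x t) (fderiv ℝ (fun p : ℝ × ℝ => F p.1 p.2) (θ, t) (1, 0)) θ :=
  HasFDerivAt.comp_hasDerivAt (f := fun x => (x, t)) θ (hF.hasFDerivAt ht)
    ((hasDerivAt_id θ).prodMk (hasDerivAt_const θ t))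

theorem hasDerivAt_time_fderiv (hF : SmoothBefore T F) (ht : t < T) :
    HasDerivAt (fun s => F θ s) (fderiv ℝ (fun p : ℝ × ℝ => F p.1 p.2) (θ, t) (0, 1)) t :=
  HasFDerivAt.comp_hasDerivAt (f := fun s => (θ, s)) t (hF.hasFDerivAt ht)
    ((hasDerivAt_const t θ).prodMk (hasDerivAt_id t))

theorem hasDerivAt_angle (hF : SmoothBefore T F) (ht : t < T) :
    HasDerivAt (fun x => F x t) (angleDeriv F θ t) θ :=
  (hF.hasDerivAt_angle_fderiv ht).differentiableAt.hasDerivAt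

theorem hasDerivAt_time (hF : SmoothBefore T F) (ht : t < T) :
    HasDerivAt (fun s => F θ s) (timeDeriv F θ t) t :=
  (hF.hasDerivAt_time_fderiv ht).differentiableAt.hasDerivAt

theorem angleDeriv_eq (hF : SmoothBefore T F) (ht : t < T) :
    angleDeriv F θ t = fderiv ℝ (fun p : ℝ × ℝ => F p.1 p.2) (θ, t) (1, 0) :=
  (hF.hasDerivAt_angle ht).unique (hF.hasDerivAt_angle_fderiv ht)

theorem timeDeriv_eq (hF : SmoothBefore T F) (ht : t < T) :
    timeDeriv F θ t = fderiv ℝ (fun p : ℝ × ℝ => F p.1 p.2) (θ, t) (0, 1) :=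
  (hF.hasDerivAt_time ht).unique (hF.hasDerivAt_time_fderiv ht)

theorem contDiffOn_fderiv (hF : SmoothBefore T F) :
    ContDiffOn ℝ (⊤ : ℕ∞) (fderiv ℝ (fun p : ℝ × ℝ => F p.1 p.2)) (univ ×ˢ Iio T) :=
  ContDiffOn.fderiv_of_isOpen hF (isOpen_univ.prod isOpen_Iio) (by simp)

theorem deriv_angle (hF : SmoothBefore T F) : SmoothBefore T (angleDeriv F) :=
  (hF.contDiffOn_fderiv.clm_apply contDiffOn_const).congr fun _ hp => hF.angleDeriv_eq hp.2

theorem deriv_time (hF : SmoothBefore T F) : SmoothBefore T (timeDeriv F) :=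
  (hF.contDiffOn_fderiv.clm_apply contDiffOn_const).congr fun _ hp => hF.timeDeriv_eq hp.2

theorem timeDeriv_angleDeriv (hF : SmoothBefore T F) (ht : t < T) :
    timeDeriv (angleDeriv F) θ t = angleDeriv (timeDeriv F) θ t := by
  have hopen : (univ ×ˢ Iio T : Set (ℝ × ℝ)) ∈ nhds (θ, t) :=
    (isOpen_univ.prod isOpen_Iio).mem_nhds ⟨mem_univ _, ht⟩
  have hd : HasFDerivAt (fderiv ℝ (fun p : ℝ × ℝ => F p.1 p.2))
      (fderiv ℝ (fderiv ℝ (fun p : ℝ × ℝ => F p.1 p.2)) (θ, t)) (θ, t) :=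
    ((hF.contDiffOn_fderiv.contDiffAt hopen).differentiableAt (by simp)).hasFDerivAt
  have key : ∀ u w : ℝ × ℝ,
      fderiv ℝ (fun p : ℝ × ℝ => fderiv ℝ (fun p : ℝ × ℝ => F p.1 p.2) p u) (θ, t) w =
        fderiv ℝ (fderiv ℝ (fun p : ℝ × ℝ => F p.1 p.2)) (θ, t) w u := fun u w => by
    have h := hd.clm_apply (hasFDerivAt_const u (θ, t))
    rw [h.fderiv]
    simp
  have hsymm := (hF.contDiffAt (θ := θ) ht).isSymmSndFDerivAt (by
    rw [minSmoothness_of_isRCLikeNormedField]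
    exact WithTop.coe_le_coe.2 (le_top : (2 : ℕ∞) ≤ ⊤))
  rw [hF.deriv_angle.timeDeriv_eq ht, hF.deriv_time.angleDeriv_eq ht,
    Filter.EventuallyEq.fderiv_eq (𝕜 := ℝ)
      (f := fun p : ℝ × ℝ => fderiv ℝ (fun p : ℝ × ℝ => F p.1 p.2) p (1, 0))
      (Filter.eventuallyEq_of_mem hopen fun p hp => hF.angleDeriv_eq hp.2),
    Filter.EventuallyEq.fderiv_eq (Filter.eventuallyEq_of_mem hopen
      (fun p hp => hF.timeDeriv_eq hp.2)), key, key]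
  exact hsymm _ _

theorem timeDeriv_angleDeriv_angleDeriv (hF : SmoothBefore T F) (ht : t < T) :
    timeDeriv (angleDeriv (angleDeriv F)) θ t = angleDeriv (angleDeriv (timeDeriv F)) θ t := by
  rw [hF.deriv_angle.timeDeriv_angleDeriv ht]
  have e : (fun x => timeDeriv (angleDeriv F) x t) = fun x => angleDeriv (timeDeriv F) x t :=
    funext fun x => hF.timeDeriv_angleDeriv ht
  exact congrArg (fun f : ℝ → ℝ => deriv f θ) e

theorem continuous_angle (hF : SmoothBefore T F) (ht : t < T) : Continuous fun x => F x t :=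
  continuous_iff_continuousAt.2 fun _ => (hF.hasDerivAt_angle ht).continuousAt

theorem add (hF : SmoothBefore T F) (hG : SmoothBefore T G) :
    SmoothBefore T fun θ t => F θ t + G θ t :=
  ContDiffOn.add hF hG

theorem mul (hF : SmoothBefore T F) (hG : SmoothBefore T G) :
    SmoothBefore T fun θ t => F θ t * G θ t :=
  ContDiffOn.mul hF hG

theorem neg (hF : SmoothBefore T F) : SmoothBefore T fun θ t => -F θ t :=
  ContDiffOn.neg hF

theorem inv (hF : SmoothBefore T F) (h0 : ∀ θ t, t < T → F θ t ≠ 0) :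
    SmoothBefore T fun θ t => (F θ t)⁻¹ :=
  ContDiffOn.inv hF fun p hp => h0 p.1 p.2 hp.2

theorem isPeriodicC2 (hF : SmoothBefore T F) (ht : t < T)
    (hper : Function.Periodic (fun θ => F θ t) (2 * π)) :
    IsPeriodicC2 (fun θ => F θ t) (fun θ => angleDeriv F θ t)
      fun θ => angleDeriv (angleDeriv F) θ t where
  hasDerivAt _ := hF.hasDerivAt_angle ht
  hasDerivAt_deriv _ := hF.deriv_angle.hasDerivAt_angle ht
  continuous_deriv2 := hF.deriv_angle.deriv_angle.continuous_angle ht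
  periodic := hper

/-- Differentiation under the integral sign. -/
theorem hasDerivAt_integral (hF : SmoothBefore T F) (ht : t < T) {a b : ℝ} {F' : ℝ → ℝ}
    (hF' : ∀ θ, HasDerivAt (fun s => F θ s) (F' θ) t) :
    HasDerivAt (fun s => ∫ θ in a..b, F θ s) (∫ θ in a..b, F' θ) t := by
  have e : F' = fun θ => timeDeriv F θ t := funext fun θ =>
    (hF' θ).unique (hF.hasDerivAt_time ht)
  subst e
  set ε := (T - t) / 2 with hε
  have hε0 : 0 < ε := by rw [hε]; linarith
  have hlt : ∀ s ∈ Icc (t - ε) (t + ε), s < T := fun s hs => by linarith [hs.2]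
  obtain ⟨C, hC⟩ := ((isCompact_uIcc (a := a) (b := b)).prod
    (isCompact_Icc (a := t - ε) (b := t + ε))).exists_bound_of_continuousOn
    (hF.deriv_time.continuousOn.mono fun p hp => ⟨mem_univ _, hlt _ hp.2⟩)
  have hnhds : Icc (t - ε) (t + ε) ∈ nhds t := Icc_mem_nhds (by linarith) (by linarith)
  refine (intervalIntegral.hasDerivAt_integral_of_dominated_loc_of_deriv_le
    (F := fun s θ => F θ s) (F' := fun s θ => timeDeriv F θ s) (bound := fun _ => C)
    hnhds ?_ ?_ ?_ ?_ ?_ ?_).2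
  · filter_upwards [hnhds] with s hs
    exact (hF.continuous_angle (hlt s hs)).aestronglyMeasurable
  · exact (hF.continuous_angle ht).intervalIntegrable _ _
  · exact (hF.deriv_time.continuous_angle ht).aestronglyMeasurable
  · exact Filter.Eventually.of_forall fun x hx s hs => hC (x, s) ⟨uIoc_subset_uIcc hx, hs⟩
  · exact intervalIntegrable_const
  · exact Filter.Eventually.of_forall fun x _ s hs => hF.hasDerivAt_time (hlt s hs)

end SmoothBefore

theorem IsPeriodicC2.integral_mul_radius_comm {f f1 f2 g g1 g2 : ℝ → ℝ}
    (hf : IsPeriodicC2 f f1 f2) (hg : IsPeriodicC2 g g1 g2) :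
    ∫ x in 0..2 * π, f x * (g2 x + g x) = ∫ x in 0..2 * π, g x * (f2 x + f x) := by
  have hc := hf.continuous
  have hc2 := hf.continuous_deriv2
  have hgc := hg.continuous
  have hgc2 := hg.continuous_deriv2
  have h := intervalIntegral.integral_eq_sub_of_hasDerivAt (a := 0) (b := 2 * π)
    (f := fun x => f x * g1 x - g x * f1 x)
    (f' := fun x => f x * (g2 x + g x) - g x * (f2 x + f x))
    (fun x _ => (((hf.hasDerivAt x).mul (hg.hasDerivAt_deriv x)).sub
      ((hg.hasDerivAt x).mul (hf.hasDerivAt_deriv x))).congr_deriv (by ring))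
    (Continuous.intervalIntegrable (by fun_prop) _ _)
  have e0 := hf.periodic 0
  have e1 := hf.periodic_deriv 0
  have e2 := hg.periodic 0
  have e3 := hg.periodic_deriv 0
  rw [zero_add] at e0 e1 e2 e3
  rw [e0, e1, e2, e3, sub_self, intervalIntegral.integral_sub, sub_eq_zero] at h
  · exact h
  all_goals exact Continuous.intervalIntegrable (by fun_prop) _ _

section Evolution

variable {T : ℝ} {v : ℝ → ℝ → ℝ}

/-- Evolution of the affine length. -/
theorem hasDerivAt_affineLength (hv : SmoothBefore T v) (hv0 : ∀ θ t, t < T → 0 < v θ t)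
    (hflow : ∀ θ t, t < T →
      timeDeriv v θ t = 1 / 3 * (v θ t ^ 4 * (angleDeriv (angleDeriv v) θ t + v θ t)))
    {t : ℝ} (ht : t < T) :
    HasDerivAt (fun s => ∫ θ in 0..2 * π, (v θ s ^ 2)⁻¹)
      (-(2 / 3) * ∫ θ in 0..2 * π, v θ t * (angleDeriv (angleDeriv v) θ t + v θ t)) t := by
  have hs : SmoothBefore T fun θ t => (v θ t ^ 2)⁻¹ := by
    simp only [pow_two]
    exact (hv.mul hv).inv fun θ t ht => (mul_pos (hv0 θ t ht) (hv0 θ t ht)).ne'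
  rw [← intervalIntegral.integral_const_mul]
  refine hs.hasDerivAt_integral ht fun θ => ?_
  have h0 := (hv0 θ t ht).ne'
  refine (((hv.hasDerivAt_time ht).pow 2).inv (pow_ne_zero 2 h0)).congr_deriv ?_
  rw [hflow θ t ht]
  simp only [Pi.pow_apply]
  field_simp
  ring

/-- Evolution of the total affine curvature. -/
theorem hasDerivAt_totalCurvature (hv : SmoothBefore T v)
    (hper : ∀ t < T, Function.Periodic (fun θ => v θ t) (2 * π))
    (hflow : ∀ θ t, t < T →
      timeDeriv v θ t = 1 / 3 * (v θ t ^ 4 * (angleDeriv (angleDeriv v) θ t + v θ t)))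
    {t : ℝ} (ht : t < T) :
    HasDerivAt (fun s => ∫ θ in 0..2 * π, v θ s * (angleDeriv (angleDeriv v) θ s + v θ s))
      (2 / 3 * ∫ θ in 0..2 * π, v θ t ^ 4 * (angleDeriv (angleDeriv v) θ t + v θ t) ^ 2) t := by
  have hp := hv.isPeriodicC2 ht (hper t ht)
  have hpt := hv.deriv_time.isPeriodicC2 ht (fun θ => by
    simp only [hflow _ t ht]
    have h1 := hp.periodic θ
    have h2 := hp.periodic_deriv2 θ
    simp only [h1, h2])
  refine ((hv.mul (hv.deriv_angle.deriv_angle.add hv)).hasDerivAt_integral ht fun θ =>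
    (hv.hasDerivAt_time ht).mul
      ((hv.deriv_angle.deriv_angle.hasDerivAt_time ht).add (hv.hasDerivAt_time ht))).congr_deriv ?_
  have hc := hp.continuous
  have hc2 := hp.continuous_deriv2
  have htc := hpt.continuous
  have htc2 := hpt.continuous_deriv2
  simp only [hv.timeDeriv_angleDeriv_angleDeriv ht]
  rw [intervalIntegral.integral_add, hp.integral_mul_radius_comm hpt,
    ← intervalIntegral.integral_add, ← intervalIntegral.integral_const_mul]
  · congr 1; ext θ
    simp only [hflow θ t ht]
    ring
  all_goals exact Continuous.intervalIntegrable (by fun_prop) _ _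

end Evolution

/-- Solutions of the harmonic oscillator equation. -/
theorem eq_cos_add_sin_of_hasDerivAt {f f1 : ℝ → ℝ} {k : ℝ} (hk : k ≠ 0)
    (hf : ∀ x, HasDerivAt f (f1 x) x) (hf1 : ∀ x, HasDerivAt f1 (-(k ^ 2 * f x)) x) (x : ℝ) :
    f x = f 0 * cos (k * x) + f1 0 / k * sin (k * x) := by
  have hkx : ∀ y, HasDerivAt (fun y => k * y) k y := fun y => by
    simpa using (hasDerivAt_id y).const_mul k
  have hP := is_const_of_deriv_eq_zero
    (f := fun y => f y * cos (k * y) - f1 y / k * sin (k * y))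
  have hQ := is_const_of_deriv_eq_zero
    (f := fun y => f y * sin (k * y) + f1 y / k * cos (k * y))
  have hPd : ∀ y, HasDerivAt (fun y => f y * cos (k * y) - f1 y / k * sin (k * y)) 0 y := fun y =>
    (((hf y).mul (hkx y).cos).sub (((hf1 y).div_const k).mul (hkx y).sin)).congr_deriv (by
      field_simp; ring)
  have hQd : ∀ y, HasDerivAt (fun y => f y * sin (k * y) + f1 y / k * cos (k * y)) 0 y := fun y =>
    (((hf y).mul (hkx y).sin).add (((hf1 y).div_const k).mul (hkx y).cos)).congr_deriv (by
      field_simp; ring)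
  have eP := hP (fun y => (hPd y).differentiableAt) (fun y => (hPd y).deriv) x 0
  have eQ := hQ (fun y => (hQd y).differentiableAt) (fun y => (hQd y).deriv) x 0
  simp only [mul_zero, cos_zero, sin_zero, mul_one, sub_zero, zero_add] at eP eQ
  rw [← eP, ← eQ]
  linear_combination -f x * cos_sq_add_sin_sq (k * x)

/-- A positive function with constant affine curvature `m` is the square root of a quadratic form
of determinant `m` on the unit circle. -/
theorem exists_sq_eq_of_affineCurvature_eq {v v1 v2 : ℝ → ℝ} {m : ℝ}
    (hv : ∀ x, HasDerivAt v (v1 x) x) (hv1 : ∀ x, HasDerivAt v1 (v2 x) x) (hv0 : ∀ x, 0 < v x)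
    (hm : ∀ x, v x ^ 3 * (v2 x + v x) = m) :
    ∃ a b d : ℝ, a * d - b ^ 2 = m ∧
      ∀ x, v x ^ 2 = a * cos x ^ 2 + 2 * b * (cos x * sin x) + d * sin x ^ 2 := by
  have hE : ∀ x, HasDerivAt (fun x => v1 x ^ 2 + v x ^ 2 + m * (v x ^ 2)⁻¹) 0 x := fun x => by
    have h0 := (hv0 x).ne'
    refine ((((hv1 x).pow 2).add ((hv x).pow 2)).add
      ((((hv x).pow 2).inv (pow_ne_zero 2 h0)).const_mul m)).congr_deriv ?_
    simp only [Pi.pow_apply, ← hm x]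
    field_simp
    ring
  have hconst := fun x => is_const_of_deriv_eq_zero (fun x => (hE x).differentiableAt)
    (fun x => (hE x).deriv) x 0
  set A := (v1 0 ^ 2 + v 0 ^ 2 + m * (v 0 ^ 2)⁻¹) / 2 with hA
  have hsq : ∀ x, v1 x ^ 2 + v x ^ 2 + m * (v x ^ 2)⁻¹ = 2 * A := fun x => by
    rw [hconst x, hA]; ring
  have hsol := eq_cos_add_sin_of_hasDerivAt (f := fun x => v x ^ 2 - A)
    (f1 := fun x => 2 * (v x * v1 x)) (two_ne_zero (α := ℝ))
    (fun x => (((hv x).pow 2).sub_const A).congr_deriv (by push_cast; ring))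
    (fun x => (((hv x).mul (hv1 x)).const_mul 2).congr_deriv (by
      have h0 := (hv0 x).ne'
      have h1 := hsq x
      have h2 := hm x
      field_simp at h1 ⊢
      have h3 : v x ^ 2 * (2 * (v1 x ^ 2 + v x * v2 x) + 4 * (v x ^ 2 - A)) = 0 := by
        linear_combination 2 * h1 + 2 * h2
      have h4 := (mul_eq_zero.1 h3).resolve_left (pow_ne_zero 2 h0)
      linarith))
  refine ⟨A + (v 0 ^ 2 - A), v 0 * v1 0, A - (v 0 ^ 2 - A), ?_, fun x => ?_⟩
  · have h0 := (hv0 0).ne'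
    rw [hA]
    field_simp
    ring
  · have := hsol x
    rw [cos_two_mul, sin_two_mul] at this
    linear_combination this + (v 0 ^ 2 - 2 * A) * cos_sq_add_sin_sq x

/-- If `L * M` is constant along the evolution then the affine curvature has zero variance and
`L ^ 2` is an affine function of time. -/
theorem exists_extinction_time {T Y : ℝ} {L M N : ℝ → ℝ} (hY : 0 < Y)
    (hL : ∀ t < T, HasDerivAt L (-(2 / 3) * M t) t) (hM : ∀ t < T, HasDerivAt M (2 / 3 * N t) t)
    (hL0 : ∀ t < T, 0 < L t) (hLM : ∀ t < T, L t * M t = Y) :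
    (∀ t < T, N t - M t ^ 2 / L t = 0) ∧
      ∃ T₀ ≥ T, ∀ t < T, t < T₀ ∧ L t ^ 2 = 4 / 3 * Y * (T₀ - t) := by
  refine ⟨fun t ht => ?_, ?_⟩
  · have h1 := (hL t ht).mul (hM t ht)
    have h2 : HasDerivAt (L * M) 0 t := (hasDerivAt_const t Y).congr_of_eventuallyEq
      (Filter.eventuallyEq_of_mem (Iio_mem_nhds ht) hLM)
    have h3 := h1.unique h2
    have := (hL0 t ht).ne'
    field_simp
    linarith
  · have hd : ∀ t < T, HasDerivAt (fun t => L t ^ 2 + 4 / 3 * Y * t) 0 t := fun t ht =>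
      (((hL t ht).pow 2).add ((hasDerivAt_id t).const_mul (4 / 3 * Y))).congr_deriv (by
        simp [← hLM t ht]; ring)
    have hc : ∀ t < T, L t ^ 2 + 4 / 3 * Y * t = L (T - 1) ^ 2 + 4 / 3 * Y * (T - 1) :=
      fun t ht => isOpen_Iio.is_const_of_deriv_eq_zero isPreconnected_Iio
        (fun s hs => (hd s hs).differentiableAt.differentiableWithinAt)
        (fun s hs => (hd s hs).deriv) ht (mem_Iio.2 (by linarith))
    set T₀ := (L (T - 1) ^ 2 + 4 / 3 * Y * (T - 1)) / (4 / 3 * Y) with hT₀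
    have he : ∀ t < T, L t ^ 2 = 4 / 3 * Y * (T₀ - t) := fun t ht => by
      have : 4 / 3 * Y * T₀ = L (T - 1) ^ 2 + 4 / 3 * Y * (T - 1) := by
        rw [hT₀]; field_simp
      linarith [hc t ht]
    have hlt : ∀ t < T, t < T₀ := fun t ht => by
      have h1 := pow_pos (hL0 t ht) 2
      rw [he t ht] at h1
      linarith [pos_of_mul_pos_right h1 (by positivity)]
    exact ⟨T₀, le_of_forall_lt hlt, fun t ht => ⟨hlt t ht, he t ht⟩⟩

theorem posDef_of_det_pos {a b d : ℝ} (ha : 0 < a) (hdet : 0 < a * d - b ^ 2) :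
    (!![a, b; b, d] : Matrix (Fin 2) (Fin 2) ℝ).PosDef := by
  refine Matrix.PosDef.of_dotProduct_mulVec_pos ?_ fun x hx => ?_
  · ext i j
    fin_cases i <;> fin_cases j <;> simp
  · have h : x 0 ≠ 0 ∨ x 1 ≠ 0 := by
      by_contra! h
      exact hx (funext fun i => by fin_cases i <;> simp [h])
    simp only [star_trivial, dotProduct, mulVec, Fin.sum_univ_two, of_apply, cons_val_zero,
      cons_val_one]
    refine pos_of_mul_pos_right (a := a) ?_ ha.le
    have e : a * (x 0 * (a * x 0 + b * x 1) + x 1 * (b * x 0 + d * x 1)) =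
        (a * x 0 + b * x 1) ^ 2 + (a * d - b ^ 2) * x 1 ^ 2 := by ring
    rw [e]
    by_cases h1 : x 1 = 0
    · have := h.resolve_right (not_not.2 h1)
      have : 0 < (a * x 0) ^ 2 := by positivity
      rw [h1]
      linarith
    · positivity

section Flow

variable {T : ℝ} {h : ℝ → ℝ → ℝ}

theorem radius_mul_speed_pow {r v : ℝ} (hr : 0 < r) (hv : v = r ^ (-(1 : ℝ) / 3)) :
    0 < v ∧ r * v ^ 3 = 1 := by
  refine ⟨hv ▸ rpow_pos_of_pos hr _, ?_⟩
  rw [hv, ← rpow_natCast, ← rpow_mul hr.le]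
  norm_num [rpow_neg_one, hr.ne']

/-- Evolution of the normal speed. -/
theorem timeDeriv_speed (hh : SmoothBefore T h) {v : ℝ → ℝ → ℝ} (hv : SmoothBefore T v)
    (hflow : ∀ θ t, t < T → timeDeriv h θ t = -v θ t)
    (hr : ∀ θ t, t < T → (angleDeriv (angleDeriv h) θ t + h θ t) * v θ t ^ 3 = 1)
    (θ t : ℝ) (ht : t < T) :
    timeDeriv v θ t = 1 / 3 * (v θ t ^ 4 * (angleDeriv (angleDeriv v) θ t + v θ t)) := by
  have e : ∀ x, angleDeriv (timeDeriv h) x t = -angleDeriv v x t := fun x => by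
    have e' : (fun y => timeDeriv h y t) = fun y => -v y t := funext fun y => hflow y t ht
    exact (congrArg (fun f : ℝ → ℝ => deriv f x) e').trans (deriv.fun_neg ..)
  have e2 : angleDeriv (angleDeriv (timeDeriv h)) θ t = -angleDeriv (angleDeriv v) θ t :=
    (congrArg (fun f : ℝ → ℝ => deriv f θ) (funext e)).trans (deriv.fun_neg ..)
  have h1 := ((hh.deriv_angle.deriv_angle.hasDerivAt_time (θ := θ) ht).add
    (hh.hasDerivAt_time (θ := θ) ht)).mul ((hv.hasDerivAt_time (θ := θ) ht).pow 3)
  have h2 := (hasDerivAt_const t (1 : ℝ)).congr_of_eventuallyEq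
    (Filter.eventuallyEq_of_mem (Iio_mem_nhds ht) fun s hs => hr θ s hs)
  have h3 := h1.unique h2
  rw [hh.timeDeriv_angleDeriv_angleDeriv ht, e2, hflow θ t ht] at h3
  simp only [Pi.add_apply, Pi.pow_apply] at h3
  push_cast at h3
  have h4 := hr θ t ht
  linear_combination v θ t / 3 * h3 - timeDeriv v θ t * h4

/-- An ancient solution has constant affine curvature on each time slice, equal to
`3 / (4 (T₀ - t))` for some `T₀ ≥ T`. -/
theorem exists_affineCurvature_eq (hh : SmoothBefore T h)
    (hper : ∀ t < T, Function.Periodic (fun θ => h θ t) (2 * π)) {v : ℝ → ℝ → ℝ}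
    (hv : SmoothBefore T v) (hv0 : ∀ θ t, t < T → 0 < v θ t)
    (hvper : ∀ t < T, Function.Periodic (fun θ => v θ t) (2 * π))
    (hr : ∀ θ t, t < T → (angleDeriv (angleDeriv h) θ t + h θ t) * v θ t ^ 3 = 1)
    (hflow : ∀ θ t, t < T →
      timeDeriv v θ t = 1 / 3 * (v θ t ^ 4 * (angleDeriv (angleDeriv v) θ t + v θ t))) :
    ∃ T₀ ≥ T, ∀ t < T, t < T₀ ∧ ∀ θ,
      v θ t ^ 3 * (angleDeriv (angleDeriv v) θ t + v θ t) = 3 / (4 * (T₀ - t)) := by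
  obtain ⟨L, hL⟩ : ∃ L : ℝ → ℝ, L = fun t => ∫ θ in 0..2 * π, (v θ t ^ 2)⁻¹ := ⟨_, rfl⟩
  obtain ⟨M, hM⟩ : ∃ M : ℝ → ℝ, M = fun t => ∫ θ in 0..2 * π,
    v θ t * (angleDeriv (angleDeriv v) θ t + v θ t) := ⟨_, rfl⟩
  obtain ⟨N, hN⟩ : ∃ N : ℝ → ℝ, N = fun t => ∫ θ in 0..2 * π,
    v θ t ^ 4 * (angleDeriv (angleDeriv v) θ t + v θ t) ^ 2 := ⟨_, rfl⟩
  have hLt := fun t => congrFun hL t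
  have hMt := fun t => congrFun hM t
  have hNt := fun t => congrFun hN t
  have hvp := fun t (ht : t < T) => hv.isPeriodicC2 ht (hvper t ht)
  have hhp := fun t (ht : t < T) => hh.isPeriodicC2 ht (hper t ht)
  have hLd : ∀ t < T, HasDerivAt L (-(2 / 3) * M t) t := fun t ht => by
    rw [hL, hM]; exact hasDerivAt_affineLength hv hv0 hflow ht
  have hMd : ∀ t < T, HasDerivAt M (2 / 3 * N t) t := fun t ht => by
    rw [hM, hN]; exact hasDerivAt_totalCurvature hv hvper hflow ht
  have hL0 : ∀ t < T, 0 < L t := fun t ht => by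
    have hc := (hvp t ht).continuous
    rw [hLt]
    exact intervalIntegral.intervalIntegral_pos_of_pos
      (((hc.pow 2).inv₀ fun θ => (pow_pos (hv0 θ t ht) 2).ne').intervalIntegrable _ _)
      (fun θ => inv_pos.2 (pow_pos (hv0 θ t ht) 2)) (by positivity)
  have hN0 : ∀ t < T, 0 ≤ N t - M t ^ 2 / L t := fun t ht => by
    rw [← integral_affineCurvature_variance (hvp t ht) (hv0 · t ht) (hLt t) (hMt t) (hNt t)
      (hL0 t ht)]
    exact intervalIntegral.integral_nonneg (by positivity) fun _ _ => sq_nonneg _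
  have hLM : ∀ t < T, L t * M t = 4 * π ^ 2 := mul_eq_of_ancient (Y := 4 * π ^ 2)
    (C := 4 * π ^ 2) (by positivity) (by positivity) hLd hMd hL0 hN0
    (fun t ht => affineLength_mul_totalCurvature_le (hhp t ht) (hvp t ht) (hv0 · t ht)
      (hr · t ht) (hLt t) (hMt t))
    (fun t ht hM0 => sq_one_sub_le_variance (hhp t ht) (hvp t ht) (hv0 · t ht)
      (hr · t ht) (hLt t) (hMt t) (hNt t) (hL0 t ht) hM0)
  obtain ⟨hvar, T₀, hT₀, hext⟩ := exists_extinction_time (by positivity) hLd hMd hL0 hLM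
  refine ⟨T₀, hT₀, fun t ht => ⟨(hext t ht).1, fun θ => ?_⟩⟩
  rw [affineCurvature_eq_of_variance_eq_zero (hvp t ht) (hv0 · t ht) (hLt t) (hMt t) (hNt t)
    (hL0 t ht) (hvar t ht)]
  have h0 := (hL0 t ht).ne'
  have h1 : T₀ - t ≠ 0 := (sub_pos.2 (hext t ht).1).ne'
  have h2 := (hext t ht).2
  have h3 : (π : ℝ) ≠ 0 := pi_pos.ne'
  have h4 : L t * (M t * (4 * (T₀ - t)) - 3 * L t) = 0 := by
    linear_combination 4 * (T₀ - t) * hLM t ht - 3 * h2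
  rw [div_eq_div_iff h0 (by positivity)]
  linarith [(mul_eq_zero.1 h4).resolve_left h0]

end Flow

theorem mul_eq_rpow_mul_sqrt {σ₀ σ v₀ v : ℝ} (hσ₀ : 0 < σ₀) (hσ : 0 < σ) (hv : 0 < v)
    (h : σ * v ^ 4 = σ₀ * v₀ ^ 4) : σ * v = σ ^ ((3 : ℝ) / 4) * √(√σ₀ * v₀ ^ 2) := by
  have h1 : √σ₀ * v₀ ^ 2 = √σ * v ^ 2 := by
    rw [← sq_eq_sq₀ (by positivity) (by positivity), mul_pow, mul_pow, sq_sqrt hσ₀.le,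
      sq_sqrt hσ.le]
    linarith
  rw [h1, sqrt_mul (by positivity), sqrt_sq hv.le, sqrt_eq_rpow, sqrt_eq_rpow,
    ← rpow_mul hσ.le, ← mul_assoc, ← rpow_add hσ]
  norm_num

/-- Classification of compact convex ancient solutions of the affine curve shortening flow,
in support-function form: any smooth ancient support-function solution
(`2π`-periodic in `θ`, with positive radius of curvature `∂²h/∂θ² + h`, and satisfying
`∂h/∂t = −(∂²h/∂θ² + h)^{−1/3}` on `ℝ × (−∞, T)`) is a shrinking ellipse, i.e. there are
`T₀ ≥ T`, a center `c ∈ ℝ²`, and a symmetric positive definite matrix `Q₀` with `det Q₀ = 1`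
such that `h(θ,t) = ⟨c, u(θ)⟩ + ((4/3)(T₀−t))^{3/4} √(u(θ)ᵀ Q₀ u(θ))`. -/
theorem ancient_ACSF_solution_is_shrinking_ellipse
    (T : ℝ) (h : ℝ → ℝ → ℝ)
    (hsmooth : ContDiffOn ℝ (⊤ : ℕ∞) (fun p : ℝ × ℝ => h p.1 p.2) (Set.univ ×ˢ Set.Iio T))
    (hper : ∀ t : ℝ, t < T → Function.Periodic (fun θ => h θ t) (2 * Real.pi))
    (hradius : ∀ θ t : ℝ, t < T → 0 < iteratedDeriv 2 (fun θ' => h θ' t) θ + h θ t)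
    (hflow : ∀ θ t : ℝ, t < T → deriv (fun s => h θ s) t =
      -(iteratedDeriv 2 (fun θ' => h θ' t) θ + h θ t) ^ (-(1 : ℝ) / 3)) :
    ∃ (T₀ : ℝ) (c : Fin 2 → ℝ) (Q₀ : Matrix (Fin 2) (Fin 2) ℝ),
      T ≤ T₀ ∧ Q₀.PosDef ∧ Q₀.det = 1 ∧
      ∀ θ t : ℝ, t < T → h θ t =
        dotProduct c (normalVec θ) +
          ((4 / 3 : ℝ) * (T₀ - t)) ^ ((3 : ℝ) / 4) *
            Real.sqrt (dotProduct (normalVec θ) (Q₀.mulVec (normalVec θ))) := by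
  have hh : SmoothBefore T h := hsmooth
  have hr0 : ∀ θ t, t < T → 0 < angleDeriv (angleDeriv h) θ t + h θ t := fun θ t ht => by
    have := hradius θ t ht
    rwa [iteratedDeriv_succ, iteratedDeriv_one] at this
  set v : ℝ → ℝ → ℝ := fun θ t => -timeDeriv h θ t with hvdef
  have hv : SmoothBefore T v := hh.deriv_time.neg
  have hvr : ∀ θ t, t < T → v θ t = (angleDeriv (angleDeriv h) θ t + h θ t) ^ (-(1 : ℝ) / 3) :=
    fun θ t ht => by
      have := hflow θ t ht
      rw [iteratedDeriv_succ, iteratedDeriv_one] at this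
      exact neg_eq_iff_eq_neg.2 this
  have hv0 := fun θ t (ht : t < T) => (radius_mul_speed_pow (hr0 θ t ht) (hvr θ t ht)).1
  have hr := fun θ t (ht : t < T) => (radius_mul_speed_pow (hr0 θ t ht) (hvr θ t ht)).2
  have hht : ∀ θ t, t < T → timeDeriv h θ t = -v θ t := fun θ t _ => (neg_neg _).symm
  have hhp := fun t (ht : t < T) => hh.isPeriodicC2 ht (hper t ht)
  have hvper : ∀ t < T, Function.Periodic (fun θ => v θ t) (2 * π) := fun t ht θ => by
    have h1 := (hhp t ht).periodic θ
    have h2 := (hhp t ht).periodic_deriv2 θ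
    simp only [hvr _ t ht, h1, h2]
  have hvt := timeDeriv_speed hh hv hht hr
  obtain ⟨T₀, hT₀, hcurv⟩ := exists_affineCurvature_eq hh hper hv hv0 hvper hr hvt
  have hvt' : ∀ θ t, t < T → 4 * (T₀ - t) * timeDeriv v θ t = v θ t := fun θ t ht => by
    obtain ⟨hlt, hc⟩ := hcurv t ht
    have h1 := hc θ
    have h2 := (sub_pos.2 hlt).ne'
    rw [eq_div_iff (by positivity)] at h1
    rw [hvt θ t ht]
    linear_combination v θ t / 3 * h1
  set t₀ := T - 1 with ht₀
  have ht₀T : t₀ < T := by rw [ht₀]; linarith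
  have const : ∀ {f : ℝ → ℝ}, (∀ t < T, HasDerivAt f 0 t) → ∀ t < T, f t = f t₀ :=
    fun hf t ht => isOpen_Iio.is_const_of_deriv_eq_zero isPreconnected_Iio
      (fun s hs => (hf s hs).differentiableAt.differentiableWithinAt)
      (fun s hs => (hf s hs).deriv) ht (mem_Iio.2 ht₀T)
  have hτ : ∀ t, HasDerivAt (fun t => 4 / 3 * (T₀ - t)) (-(4 / 3)) t := fun t =>
    (((hasDerivAt_id t).const_sub T₀).const_mul (4 / 3 : ℝ)).congr_deriv (by norm_num)
  have hscale : ∀ θ t, t < T → 4 / 3 * (T₀ - t) * v θ t ^ 4 = 4 / 3 * (T₀ - t₀) * v θ t₀ ^ 4 :=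
    fun θ => const fun t ht => ((hτ t).mul ((hv.hasDerivAt_time ht).pow 4)).congr_deriv (by
      simp only [Pi.pow_apply]
      push_cast
      linear_combination 4 / 3 * v θ t ^ 3 * hvt' θ t ht)
  have hcenter : ∀ θ t, t < T →
      h θ t - 4 / 3 * (T₀ - t) * v θ t = h θ t₀ - 4 / 3 * (T₀ - t₀) * v θ t₀ :=
    fun θ => const fun t ht => ((hh.hasDerivAt_time ht).sub
      ((hτ t).mul (hv.hasDerivAt_time ht))).congr_deriv (by
        rw [hht θ t ht]
        linear_combination -(1 / 3) * hvt' θ t ht)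
  have hvp := hv.isPeriodicC2 ht₀T (hvper t₀ ht₀T)
  obtain ⟨hlt₀, hcurv₀⟩ := hcurv t₀ ht₀T
  set σ₀ := 4 / 3 * (T₀ - t₀) with hσ₀
  have hσ₀pos : 0 < σ₀ := by rw [hσ₀]; linarith
  have hm : 3 / (4 * (T₀ - t₀)) = σ₀⁻¹ := by rw [hσ₀]; field_simp
  rw [hm] at hcurv₀
  obtain ⟨a, b, d, hdet, hquad⟩ := exists_sq_eq_of_affineCurvature_eq hvp.hasDerivAt
    hvp.hasDerivAt_deriv (hv0 · t₀ ht₀T) hcurv₀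
  have hosc := eq_cos_add_sin_of_hasDerivAt (f := fun θ => h θ t₀ - σ₀ * v θ t₀)
    (f1 := fun θ => angleDeriv h θ t₀ - σ₀ * angleDeriv v θ t₀) (one_ne_zero (α := ℝ))
    (fun θ => ((hhp t₀ ht₀T).hasDerivAt θ).sub ((hvp.hasDerivAt θ).const_mul σ₀))
    (fun θ => (((hhp t₀ ht₀T).hasDerivAt_deriv θ).sub
      ((hvp.hasDerivAt_deriv θ).const_mul σ₀)).congr_deriv (by
        have h1 := hr θ t₀ ht₀T
        have h2 : σ₀ * (v θ t₀ ^ 3 * (angleDeriv (angleDeriv v) θ t₀ + v θ t₀)) = 1 := by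
          rw [hcurv₀ θ, mul_inv_cancel₀ hσ₀pos.ne']
        refine mul_left_cancel₀ (pow_ne_zero 3 (hv0 θ t₀ ht₀T).ne') ?_
        linear_combination h1 - h2))
  have hsdet : √σ₀ * a * (√σ₀ * d) - (√σ₀ * b) ^ 2 = 1 := by
    have e := mul_self_sqrt hσ₀pos.le
    have e2 : σ₀ * (a * d - b ^ 2) = 1 := by rw [hdet, mul_inv_cancel₀ hσ₀pos.ne']
    linear_combination (a * d - b ^ 2) * e + e2
  have ha : 0 < a := by
    have := hquad 0
    simp only [cos_zero, sin_zero] at this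
    nlinarith [pow_pos (hv0 0 t₀ ht₀T) 2]
  refine ⟨T₀, ![h 0 t₀ - σ₀ * v 0 t₀, angleDeriv h 0 t₀ - σ₀ * angleDeriv v 0 t₀],
    !![√σ₀ * a, √σ₀ * b; √σ₀ * b, √σ₀ * d], hT₀, posDef_of_det_pos (by positivity)
      (by rw [hsdet]; exact one_pos), ?_, fun θ t ht => ?_⟩
  · rw [det_fin_two_of, ← hsdet]; ring
  · have hσ : 0 < 4 / 3 * (T₀ - t) := by linarith [(hcurv t ht).1]
    have hq : normalVec θ ⬝ᵥ (!![√σ₀ * a, √σ₀ * b; √σ₀ * b, √σ₀ * d] *ᵥ normalVec θ) =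
        √σ₀ * v θ t₀ ^ 2 := by
      rw [hquad θ]
      simp [normalVec, dotProduct, mulVec, Fin.sum_univ_two]
      ring
    have h1 := hosc θ
    simp only [one_mul, div_one] at h1
    rw [hq, ← mul_eq_rpow_mul_sqrt hσ₀pos hσ (hv0 θ t ht) (hscale θ t ht)]
    simp only [normalVec, dotProduct, Fin.sum_univ_two, cons_val_zero, cons_val_one]
    linear_combination hcenter θ t ht + h1

end
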